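/- arXiv:1810.12437 — 5 statements merged into one kernel-verified Lean document; each statement's English description precedes it below -/
import Mathlib

section
/- Let X be a real n×p matrix, Ω = diag(ω₁,…,ωₙ) a diagonal matrix with ωᵢ > 0, Λ = diag(λ₁,…,λ_p) a diagonal matrix with λⱼ > 0, τ > 0, and y' ∈ ℝⁿ, and set Φ = XᵀΩX + τ⁻²Λ⁻². If η and δ are independent random vectors with multivariate Gaussian distributions N(0, Iₙ) and N(0, I_p) respectively, then the random vector b = XᵀΩy' + XᵀΩ^{1/2}η + τ⁻¹Λ⁻¹δ has the multivariate Gaussian distribution N(XᵀΩy', Φ); consequently, if Φ is invertible, the solution β = Φ⁻¹b of the linear system Φβ = b has the multivariate Gaussian distribution N(Φ⁻¹XᵀΩy', Φ⁻¹). -/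
open Matrix MeasureTheory ProbabilityTheory

/-- A random vector `Z : Ω → ℝ^d` has the multivariate Gaussian law `N(μ, S)` under the
probability measure `P` if, for every `a : ℝ^d`, the real random variable `a ⬝ᵥ Z` has the
(one-dimensional) Gaussian law with mean `a ⬝ᵥ μ` and variance `aᵀ S a` (Cramér–Wold
characterization of the multivariate Gaussian distribution). -/
def HasGaussianLaw {Ω : Type*} [MeasurableSpace Ω] (P : Measure Ω) {d : ℕ}
    (Z : Ω → Fin d → ℝ) (μ : Fin d → ℝ) (S : Matrix (Fin d) (Fin d) ℝ) : Prop :=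
  ∀ a : Fin d → ℝ,
    Measure.map (fun ω => a ⬝ᵥ Z ω) P =
      gaussianReal (a ⬝ᵥ μ) (Real.toNNReal (a ⬝ᵥ S.mulVec a))

/-- **Proposition 1 (Gaussian vector as the solution of a linear system).**
Let `X` be a real `n × p` matrix, `Ω = diag(ω)` with `ωᵢ > 0`, `Λ = diag(λ)` with `λⱼ > 0`,
`τ > 0`, `y' ∈ ℝⁿ`, and `Φ = Xᵀ Ω X + τ⁻² Λ⁻²`.  If `η ∼ N(0, Iₙ)` and `δ ∼ N(0, I_p)` are
independent, then `b = Xᵀ Ω y' + Xᵀ Ω^{1/2} η + τ⁻¹ Λ⁻¹ δ` has law `N(Xᵀ Ω y', Φ)`, and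
consequently, if `Φ` is invertible, `β = Φ⁻¹ b` has law `N(Φ⁻¹ Xᵀ Ω y', Φ⁻¹)`. -/
theorem gaussian_as_linear_system_solution
    {Ωs : Type*} [MeasurableSpace Ωs] (P : Measure Ωs) [IsProbabilityMeasure P]
    {n p : ℕ} (X : Matrix (Fin n) (Fin p) ℝ)
    (w : Fin n → ℝ) (hw : ∀ i, 0 < w i)
    (lam : Fin p → ℝ) (hlam : ∀ j, 0 < lam j)
    (τ : ℝ) (hτ : 0 < τ) (y' : Fin n → ℝ)
    (Φ : Matrix (Fin p) (Fin p) ℝ)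
    (hΦ : Φ = Xᵀ * Matrix.diagonal w * X +
      (τ ^ 2)⁻¹ • Matrix.diagonal (fun j => ((lam j) ^ 2)⁻¹))
    (η : Ωs → Fin n → ℝ) (δ : Ωs → Fin p → ℝ)
    (hη : Measurable η) (hδ : Measurable δ)
    (hind : IndepFun η δ P)
    (hηlaw : HasGaussianLaw P η 0 (1 : Matrix (Fin n) (Fin n) ℝ))
    (hδlaw : HasGaussianLaw P δ 0 (1 : Matrix (Fin p) (Fin p) ℝ))
    (b : Ωs → Fin p → ℝ)
    (hb : b = fun ω =>
      Xᵀ.mulVec ((Matrix.diagonal w).mulVec y')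
        + Xᵀ.mulVec ((Matrix.diagonal fun i => Real.sqrt (w i)).mulVec (η ω))
        + τ⁻¹ • (Matrix.diagonal fun j => (lam j)⁻¹).mulVec (δ ω)) :
    HasGaussianLaw P b (Xᵀ.mulVec ((Matrix.diagonal w).mulVec y')) Φ ∧
      (IsUnit Φ.det →
        HasGaussianLaw P (fun ω => Φ⁻¹.mulVec (b ω))
          (Φ⁻¹.mulVec (Xᵀ.mulVec ((Matrix.diagonal w).mulVec y'))) Φ⁻¹) := by
  have key : _root_.HasGaussianLaw P b (Xᵀ.mulVec ((Matrix.diagonal w).mulVec y')) Φ := by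
    intro a
    set u : Fin n → ℝ := fun i => Real.sqrt (w i) * (X.mulVec a) i with hu
    set v : Fin p → ℝ := fun j => τ⁻¹ * (lam j)⁻¹ * a j with hv
    set m := Xᵀ.mulVec ((Matrix.diagonal w).mulVec y') with hm
    have hab : (fun ω => a ⬝ᵥ b ω) =
        (fun x => a ⬝ᵥ m + x) ∘ ((fun ω => u ⬝ᵥ η ω) + (fun ω => v ⬝ᵥ δ ω)) := by
      funext ω
      have h1 : a ⬝ᵥ Xᵀ.mulVec ((Matrix.diagonal fun i => Real.sqrt (w i)).mulVec (η ω))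
          = u ⬝ᵥ η ω := by
        rw [Matrix.dotProduct_mulVec, Matrix.vecMul_transpose]
        simp only [dotProduct, Matrix.mulVec_diagonal, hu]
        exact Finset.sum_congr rfl fun i _ => by ring
      have h2 : a ⬝ᵥ (τ⁻¹ • (Matrix.diagonal fun j => (lam j)⁻¹).mulVec (δ ω)) = v ⬝ᵥ δ ω := by
        simp only [dotProduct, Matrix.mulVec_diagonal, hv, Pi.smul_apply, smul_eq_mul]
        exact Finset.sum_congr rfl fun i _ => by ring
      simp only [hb, dotProduct_add, h1, h2, Function.comp_apply, Pi.add_apply, add_assoc]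
    have hmu : Measurable (fun x : Fin n → ℝ => u ⬝ᵥ x) := by
      unfold dotProduct; fun_prop
    have hmv : Measurable (fun x : Fin p → ℝ => v ⬝ᵥ x) := by
      unfold dotProduct; fun_prop
    have hi : IndepFun (fun ω => u ⬝ᵥ η ω) (fun ω => v ⬝ᵥ δ ω) P := hind.comp hmu hmv
    have hadd := gaussianReal_add_gaussianReal_of_indepFun hi (hηlaw u) (hδlaw v)
    have hms : Measurable ((fun ω => u ⬝ᵥ η ω) + (fun ω => v ⬝ᵥ δ ω)) :=
      (hmu.comp hη).add (hmv.comp hδ)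
    have hmc : Measurable (fun x : ℝ => a ⬝ᵥ m + x) := measurable_const_add _
    rw [hab, ← Measure.map_map hmc hms, hadd,
      gaussianReal_map_const_add]
    have hvar : a ⬝ᵥ Φ.mulVec a = u ⬝ᵥ u + v ⬝ᵥ v := by
      rw [hΦ, Matrix.add_mulVec, dotProduct_add]
      congr 1
      · rw [← Matrix.mulVec_mulVec, ← Matrix.mulVec_mulVec, Matrix.dotProduct_mulVec,
          Matrix.vecMul_transpose]
        simp only [dotProduct, Matrix.mulVec_diagonal, hu]
        refine Finset.sum_congr rfl fun i _ => ?_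
        have := Real.mul_self_sqrt (hw i).le
        linear_combination (-(X.mulVec a i) ^ 2) * this
      · simp only [dotProduct, Matrix.smul_mulVec, Pi.smul_apply, Matrix.mulVec_diagonal, hv,
          smul_eq_mul]
        refine Finset.sum_congr rfl fun i _ => ?_
        rw [← inv_pow, ← inv_pow]
        ring
    have hnn : ∀ {k : ℕ} (z : Fin k → ℝ), 0 ≤ z ⬝ᵥ z := fun z =>
      Finset.sum_nonneg fun i _ => mul_self_nonneg (z i)
    rw [hvar, Real.toNNReal_add (hnn u) (hnn v)]
    simp
  refine ⟨key, fun hdet a => ?_⟩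
  have hsymm : Φᵀ = Φ := by
    rw [hΦ]
    simp [Matrix.transpose_mul, Matrix.mul_assoc]
  have hvm : ∀ z : Fin p → ℝ, a ⬝ᵥ Φ⁻¹.mulVec z = Φ⁻¹.mulVec a ⬝ᵥ z := by
    intro z
    rw [Matrix.dotProduct_mulVec, ← Matrix.mulVec_transpose, Matrix.transpose_nonsing_inv, hsymm]
  have h := key (Φ⁻¹.mulVec a)
  rw [Matrix.mulVec_mulVec a Φ Φ⁻¹, Matrix.mul_nonsing_inv _ hdet, Matrix.one_mulVec] at h
  simp only [hvm]
  exact h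
end

section
/- Let Φ be a p×p real symmetric positive definite matrix, b ∈ ℝ^p, β = Φ⁻¹b, and β₀ ∈ ℝ^p with residual r₀ = Φβ₀ − b. Let κ(Φ) = ν₁(Φ)/ν_p(Φ) be the ratio of the largest to the smallest eigenvalue of Φ. Then for every k ≥ 0, every minimizer β_k of ‖β' − β‖_Φ over the affine space β₀ + K(Φ, r₀, k) satisfies ‖β_k − β‖_Φ ≤ 2·((√κ(Φ) − 1)/(√κ(Φ) + 1))^k · ‖β₀ − β‖_Φ. -/
open Matrix

/-- The `Φ`-norm `‖v‖_Φ = (vᵀ Φ v)^{1/2}` of a vector `v : ℝ^p`. -/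
noncomputable def phiNorm {p : ℕ} (Φ : Matrix (Fin p) (Fin p) ℝ) (v : Fin p → ℝ) : ℝ :=
  Real.sqrt (v ⬝ᵥ Φ.mulVec v)

/-- The order-`k` Krylov subspace `K(Φ, r₀, k) = span {r₀, Φ r₀, …, Φ^{k-1} r₀}`. -/
def krylov {p : ℕ} (Φ : Matrix (Fin p) (Fin p) ℝ) (r₀ : Fin p → ℝ) (k : ℕ) :
    Submodule ℝ (Fin p → ℝ) :=
  Submodule.span ℝ {w | ∃ i, i < k ∧ w = (Φ ^ i).mulVec r₀}

/-- `nu A k` is the `k`-th largest eigenvalue (1-based, with multiplicity) of a real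
symmetric matrix `A`; junk value `0` if `A` is not symmetric or `k` is out of range. -/
noncomputable def nu {d : ℕ} (A : Matrix (Fin d) (Fin d) ℝ) (k : ℕ) : ℝ :=
  if h : A.IsHermitian ∧ 1 ≤ k ∧ k ≤ d then
    h.1.eigenvalues (Tuple.sort h.1.eigenvalues (Fin.rev ⟨k - 1, by omega⟩))
  else 0

open Polynomial in
lemma cg_exists_poly (m M : ℝ) (hm : 0 < m) (hM : m ≤ M) (k : ℕ) :
    ∃ q : ℝ[X], q.natDegree ≤ k ∧ q.eval 0 = 1 ∧ ∀ x, m ≤ x → x ≤ M →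
      |q.eval x| ≤ 2 * ((Real.sqrt (M / m) - 1) / (Real.sqrt (M / m) + 1)) ^ k := by
  rcases hM.eq_or_lt with rfl | hlt
  · rcases Nat.eq_zero_or_pos k with rfl | hk
    · exact ⟨1, by simp, by simp, by intro x _ _; norm_num⟩
    · refine ⟨1 - C (1 / m) * X, ?_, by simp, ?_⟩
      · refine le_trans (natDegree_sub_le _ _) ?_
        have : (C (1 / m) * X : ℝ[X]).natDegree ≤ 1 := (natDegree_C_mul_le _ _).trans natDegree_X_le
        simp only [natDegree_one]
        omega
      · intro x h1 h2
        obtain rfl : x = m := le_antisymm h2 h1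
        have : x ≠ 0 := hm.ne'
        simp [this, hk.ne']
  · set s := Real.sqrt (M / m) with hs
    have hs2 : s ^ 2 = M / m := Real.sq_sqrt (div_nonneg (hm.le.trans hM) hm.le)
    have hs1 : 1 < s := by
      rw [hs, Real.lt_sqrt (by norm_num), one_pow, lt_div_iff₀ hm]; linarith
    have hMm : M = s ^ 2 * m := by rw [hs2]; field_simp
    have hρ : 0 < (s + 1) / (s - 1) := div_pos (by linarith) (by linarith)
    set θ := Real.log ((s + 1) / (s - 1)) with hθ
    have hc : Real.cosh θ = (M + m) / (M - m) := by
      rw [Real.cosh_eq, Real.exp_neg, hθ, Real.exp_log hρ, hMm]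
      have h1 : s - 1 ≠ 0 := by linarith
      have h2 : s + 1 ≠ 0 := by linarith
      have h3 : s ^ 2 * m - m ≠ 0 := by rw [← hMm]; linarith
      have h4 : s ^ 2 - 1 ≠ 0 := by
        have : s ^ 2 - 1 = (s - 1) * (s + 1) := by ring
        rw [this]; exact mul_ne_zero h1 h2
      have h5 : m ≠ 0 := hm.ne'
      have h6 : (s ^ 2 * m + m) / (s ^ 2 * m - m) = (s ^ 2 + 1) / (s ^ 2 - 1) := by
        rw [div_eq_div_iff h3 h4]; ring
      rw [h6]
      field_simp
      ring
    have hT : (Chebyshev.T ℝ k).eval ((M + m) / (M - m)) = Real.cosh (k * θ) := by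
      rw [← hc, Chebyshev.T_real_cosh]; simp
    have hge : ((s + 1) / (s - 1)) ^ k / 2 ≤ Real.cosh (k * θ) := by
      rw [Real.cosh_eq, Real.exp_nat_mul, hθ, Real.exp_log hρ]
      have := Real.exp_pos (-(k * Real.log ((s + 1) / (s - 1))))
      linarith
    have hpos := Real.cosh_pos (k * θ)
    refine ⟨C (Real.cosh (k * θ))⁻¹ *
      (Chebyshev.T ℝ k).comp (C (-2 / (M - m)) * X + C ((M + m) / (M - m))), ?_, ?_, ?_⟩
    · refine le_trans (natDegree_C_mul_le _ _) (le_trans natDegree_comp_le ?_)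
      have h1 : (Chebyshev.T ℝ k).natDegree ≤ k := by simp
      have h2 := natDegree_linear_le (a := -2 / (M - m)) (b := (M + m) / (M - m))
      calc _ ≤ k * 1 := Nat.mul_le_mul h1 h2
        _ = k := mul_one k
    · simp only [eval_mul, eval_C, eval_comp, eval_add, eval_X, mul_zero, zero_add]
      rw [hT]; exact inv_mul_cancel₀ hpos.ne'
    · intro x h1 h2
      simp only [eval_mul, eval_C, eval_comp, eval_add, eval_X]
      rw [abs_mul, abs_of_pos (inv_pos.2 hpos)]
      have hd : 0 < M - m := by linarith
      have hx : |-2 / (M - m) * x + (M + m) / (M - m)| ≤ 1 := by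
        have : -2 / (M - m) * x + (M + m) / (M - m) = (M + m - 2 * x) / (M - m) := by ring
        rw [this, abs_le]
        constructor
        · rw [le_div_iff₀ hd]; linarith
        · rw [div_le_iff₀ hd]; linarith
      have hle := Chebyshev.abs_eval_T_real_le_one k hx
      calc _ ≤ (Real.cosh (k * θ))⁻¹ * 1 := by gcongr
        _ ≤ (((s + 1) / (s - 1)) ^ k / 2)⁻¹ := by
            rw [mul_one]; gcongr
        _ = _ := by
            rw [inv_div, ← inv_div (s + 1) (s - 1), inv_pow, div_eq_mul_inv]

lemma cg_le_nu_one {p : ℕ} (hp : 0 < p) (A : Matrix (Fin p) (Fin p) ℝ) (hA : A.IsHermitian)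
    (i : Fin p) : hA.eigenvalues i ≤ nu A 1 := by
  rw [nu, dif_pos ⟨hA, le_rfl, hp⟩]
  have := Tuple.monotone_sort hA.eigenvalues
    (a := (Tuple.sort hA.eigenvalues).symm i) (b := Fin.rev ⟨1 - 1, by omega⟩)
    (by rw [Fin.le_def, Fin.val_rev]; simp only; omega)
  simpa using this

lemma cg_nu_last_le {p : ℕ} (hp : 0 < p) (A : Matrix (Fin p) (Fin p) ℝ) (hA : A.IsHermitian)
    (i : Fin p) : nu A p ≤ hA.eigenvalues i := by
  rw [nu, dif_pos ⟨hA, hp, le_rfl⟩]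
  have := Tuple.monotone_sort hA.eigenvalues
    (a := Fin.rev ⟨p - 1, by omega⟩) (b := (Tuple.sort hA.eigenvalues).symm i)
    (by rw [Fin.le_def, Fin.val_rev]; simp only; omega)
  simpa using this

lemma cg_nu_last_pos {p : ℕ} (hp : 0 < p) (A : Matrix (Fin p) (Fin p) ℝ) (hA : A.PosDef) :
    0 < nu A p := by
  rw [nu, dif_pos ⟨hA.isHermitian, hp, le_rfl⟩]
  exact hA.eigenvalues_pos _

lemma cg_parseval {p : ℕ} (A : Matrix (Fin p) (Fin p) ℝ) (hA : A.IsHermitian)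
    (x y : Fin p → ℝ) :
    x ⬝ᵥ y = ∑ i, ((hA.eigenvectorBasis i).ofLp ⬝ᵥ x) * ((hA.eigenvectorBasis i).ofLp ⬝ᵥ y) := by
  have h := hA.eigenvectorBasis.sum_inner_mul_inner (WithLp.toLp 2 x) (WithLp.toLp 2 y)
  simp only [EuclideanSpace.inner_eq_star_dotProduct, star_trivial] at h
  rw [dotProduct_comm x y, ← h]
  refine Finset.sum_congr rfl fun i _ => ?_
  rw [dotProduct_comm y]

lemma cg_dot_mulVec {p : ℕ} (A : Matrix (Fin p) (Fin p) ℝ) (hA : A.IsHermitian)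
    (i : Fin p) (x : Fin p → ℝ) :
    (hA.eigenvectorBasis i).ofLp ⬝ᵥ A.mulVec x
      = hA.eigenvalues i * ((hA.eigenvectorBasis i).ofLp ⬝ᵥ x) := by
  have hT : Aᵀ = A := by simpa using hA.eq
  rw [dotProduct_mulVec, ← mulVec_transpose, hT, hA.mulVec_eigenvectorBasis, smul_dotProduct,
    smul_eq_mul]

open Polynomial in
lemma cg_dot_aeval {p : ℕ} (A : Matrix (Fin p) (Fin p) ℝ) (hA : A.IsHermitian)
    (i : Fin p) (q : ℝ[X]) (x : Fin p → ℝ) :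
    (hA.eigenvectorBasis i).ofLp ⬝ᵥ (aeval A q).mulVec x
      = q.eval (hA.eigenvalues i) * ((hA.eigenvectorBasis i).ofLp ⬝ᵥ x) := by
  induction q using Polynomial.induction_on' generalizing x with
  | add f g hf hg => simp [add_mulVec, dotProduct_add, hf, hg, add_mul]
  | monomial n a =>
    rw [aeval_monomial, eval_monomial, ← Algebra.smul_def, smul_mulVec, dotProduct_smul,
      smul_eq_mul, mul_assoc]
    congr 1
    induction n with
    | zero => simp
    | succ n ih =>
      rw [pow_succ', ← mulVec_mulVec, cg_dot_mulVec, ih]; ring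

open Polynomial in
lemma cg_phiNorm_le {p : ℕ} (A : Matrix (Fin p) (Fin p) ℝ) (hA : A.PosDef)
    (q : ℝ[X]) (c : ℝ) (hc : 0 ≤ c) (hq : ∀ i, |q.eval (hA.isHermitian.eigenvalues i)| ≤ c)
    (x : Fin p → ℝ) : phiNorm A ((aeval A q).mulVec x) ≤ c * phiNorm A x := by
  unfold phiNorm
  rw [← Real.sqrt_sq hc, ← Real.sqrt_mul (sq_nonneg c)]
  apply Real.sqrt_le_sqrt
  rw [cg_parseval A hA.isHermitian, cg_parseval A hA.isHermitian x, Finset.mul_sum]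
  refine Finset.sum_le_sum fun i _ => ?_
  simp only [cg_dot_mulVec, cg_dot_aeval]
  have h1 := (hA.eigenvalues_pos i).le
  have h2 : (q.eval (hA.isHermitian.eigenvalues i)) ^ 2 ≤ c ^ 2 := sq_le_sq' 
    (abs_le.1 (hq i)).1 (abs_le.1 (hq i)).2
  have h3 := mul_le_mul_of_nonneg_right h2 
    (mul_nonneg h1 (sq_nonneg ((hA.isHermitian.eigenvectorBasis i).ofLp ⬝ᵥ x)))
  nlinarith [h3]

open Polynomial in
lemma cg_aeval_mem {p : ℕ} (A : Matrix (Fin p) (Fin p) ℝ) (r : Fin p → ℝ) (k : ℕ)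
    (s : ℝ[X]) (hs : ∀ n, k ≤ n → s.coeff n = 0) : (aeval A s).mulVec r ∈ krylov A r k := by
  rw [aeval_eq_sum_range, sum_mulVec]
  refine Submodule.sum_mem _ fun i _ => ?_
  rw [smul_mulVec]
  by_cases hi : i < k
  · exact Submodule.smul_mem _ _ (Submodule.subset_span ⟨i, hi, rfl⟩)
  · rw [hs i (by omega), zero_smul]; exact Submodule.zero_mem _

/-- **Theorem 1 (CG condition-number bound).** If `Φ` is a `p × p` real symmetric positive
definite matrix with condition number `κ(Φ) = ν₁(Φ)/ν_p(Φ)`, `β = Φ⁻¹ b` and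
`r₀ = Φ β₀ - b`, then every `k`-th CG iterate `β_k` (i.e. every minimizer of the `Φ`-norm
distance to `β` over the affine space `β₀ + K(Φ, r₀, k)`) satisfies
`‖β_k - β‖_Φ ≤ 2 ((√κ - 1)/(√κ + 1))^k ‖β₀ - β‖_Φ`. -/
theorem cg_condition_number_bound {p : ℕ} (hp : 0 < p)
    (Φ : Matrix (Fin p) (Fin p) ℝ) (hΦ : Φ.PosDef)
    (b β₀ β r₀ : Fin p → ℝ)
    (hβ : β = Φ⁻¹.mulVec b)
    (hr₀ : r₀ = Φ.mulVec β₀ - b)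
    (κ : ℝ) (hκ : κ = nu Φ 1 / nu Φ p)
    (k : ℕ) (βk : Fin p → ℝ)
    (hmem : βk - β₀ ∈ krylov Φ r₀ k)
    (hmin : ∀ β' : Fin p → ℝ, β' - β₀ ∈ krylov Φ r₀ k →
      phiNorm Φ (βk - β) ≤ phiNorm Φ (β' - β)) :
    phiNorm Φ (βk - β) ≤
      2 * ((Real.sqrt κ - 1) / (Real.sqrt κ + 1)) ^ k * phiNorm Φ (β₀ - β) := by

  have hm := cg_nu_last_pos hp Φ hΦ
  have hM : nu Φ p ≤ nu Φ 1 :=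
    (cg_nu_last_le hp Φ hΦ.isHermitian ⟨0, hp⟩).trans (cg_le_nu_one hp Φ hΦ.isHermitian ⟨0, hp⟩)
  obtain ⟨q, hdeg, hq0, hq⟩ := cg_exists_poly _ _ hm hM k
  rw [← hκ] at hq
  have hcpos := (abs_nonneg _).trans (hq _ le_rfl hM)
  have hdet : IsUnit Φ.det := hΦ.det_pos.ne'.isUnit
  have hr : r₀ = Φ.mulVec (β₀ - β) := by
    rw [hr₀, hβ, mulVec_sub, mulVec_mulVec, Matrix.mul_nonsing_inv _ hdet, one_mulVec]
  have hdec : q = q.divX * Polynomial.X + 1 := by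
    conv_lhs => rw [← Polynomial.divX_mul_X_add q]
    rw [Polynomial.coeff_zero_eq_eval_zero, hq0, Polynomial.C_1]
  have hmem' : (β + (Polynomial.aeval Φ q).mulVec (β₀ - β)) - β₀ ∈ krylov Φ r₀ k := by
    have : (β + (Polynomial.aeval Φ q).mulVec (β₀ - β)) - β₀
        = (Polynomial.aeval Φ q.divX).mulVec r₀ := by
      conv_lhs => rw [hdec]
      rw [map_add, map_mul, Polynomial.aeval_X, map_one, add_mulVec, one_mulVec, hr,
        mulVec_mulVec]
      abel
    rw [this]
    refine cg_aeval_mem _ _ _ _ fun n hn => ?_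
    rw [Polynomial.coeff_divX]
    exact Polynomial.coeff_eq_zero_of_natDegree_lt (by omega)
  refine (hmin _ hmem').trans ?_
  rw [add_sub_cancel_left]
  exact cg_phiNorm_le Φ hΦ q _ hcpos (fun i => hq _ (cg_nu_last_le hp Φ hΦ.isHermitian i)
    (cg_le_nu_one hp Φ hΦ.isHermitian i)) _
end

section
/- Let X be a real n×p matrix, Ω a diagonal n×n matrix with nonnegative entries, τ > 0, and Λ = diag(λ₁,…,λ_p) with λⱼ > 0, and set Φ̃ = τ²Λ XᵀΩX Λ + I_p. Let b̃ ∈ ℝ^p, β̃ = Φ̃⁻¹b̃, and β̃₀ ∈ ℝ^p with residual r̃₀ = Φ̃β̃₀ − b̃. For m ≥ 0 define κ̃_m = 1 + min{ τ²λ_{(k+1)}² ν_{ℓ+1}((XᵀΩX)_{(-k)}) : k ≥ 0, ℓ ≥ 0, k + ℓ = m }. Then for all m, m' ≥ 0, every minimizer β̃_{m+m'} of ‖β̃' − β̃‖_{Φ̃} over the affine space β̃₀ + K(Φ̃, r̃₀, m + m') satisfies ‖β̃_{m+m'} − β̃‖_{Φ̃} ≤ 2·((κ̃_m^{1/2} −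 1)/(κ̃_m^{1/2} + 1))^{m'} · ‖β̃₀ − β̃‖_{Φ̃}. -/
open Matrix

/-- `subRemove A σ k hk` is the `(p - k) × (p - k)` submatrix `A_{(-k)}` of `A`
corresponding to the row and column indices `σ(k), …, σ(p-1)` (0-based), where `σ` is the
permutation `j₁, …, j_p` ordering the local scales decreasingly. -/
def subRemove {p : ℕ} (A : Matrix (Fin p) (Fin p) ℝ) (σ : Equiv.Perm (Fin p)) (k : ℕ)
    (hk : k ≤ p) : Matrix (Fin (p - k)) (Fin (p - k)) ℝ :=
  A.submatrix (fun i : Fin (p - k) => σ ⟨k + (i : ℕ), by omega⟩)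
    (fun i : Fin (p - k) => σ ⟨k + (i : ℕ), by omega⟩)

/-- The quantity `τ² λ_{(k+1)}² ν_{ℓ+1}((XᵀΩX)_{(-k)})` appearing in the definition of
`κ̃_m` (here `k` is 0-based: `λ_{(k+1)} = lam (σ k)`); junk value `0` if `k ≥ p`. -/
noncomputable def termKL {n p : ℕ} (X : Matrix (Fin n) (Fin p) ℝ) (w : Fin n → ℝ)
    (τ : ℝ) (lam : Fin p → ℝ) (σ : Equiv.Perm (Fin p)) (k ℓ : ℕ) : ℝ :=
  if h : k < p then
    τ ^ 2 * lam (σ ⟨k, h⟩) ^ 2 *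
      nu (subRemove (Xᵀ * Matrix.diagonal w * X) σ k (le_of_lt h)) (ℓ + 1)
  else 0

lemma spec_aux {d : ℕ} (A : Matrix (Fin d) (Fin d) ℝ) (h : A.IsHermitian) :
    ∃ U : Matrix (Fin d) (Fin d) ℝ, Uᵀ * U = 1 ∧ U * Uᵀ = 1 ∧
      A = U * Matrix.diagonal h.eigenvalues * Uᵀ := by
  refine ⟨(h.eigenvectorUnitary : Matrix (Fin d) (Fin d) ℝ), ?_, ?_, ?_⟩
  · have := Unitary.coe_star_mul_self h.eigenvectorUnitary
    simpa [star_eq_conjTranspose, conjTranspose_eq_transpose_of_trivial] using this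
  · have := Unitary.coe_mul_star_self h.eigenvectorUnitary
    simpa [star_eq_conjTranspose, conjTranspose_eq_transpose_of_trivial] using this
  · have := h.spectral_theorem
    rw [Unitary.conjStarAlgAut_apply] at this
    simpa [star_eq_conjTranspose, conjTranspose_eq_transpose_of_trivial, Function.comp_def]
      using this

lemma qform_aux {d : ℕ} (U : Matrix (Fin d) (Fin d) ℝ) (D : Fin d → ℝ) (v : Fin d → ℝ) :
    v ⬝ᵥ (U * Matrix.diagonal D * Uᵀ).mulVec v = ∑ i, D i * ((Uᵀ).mulVec v i) ^ 2 := by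
  rw [← mulVec_mulVec, ← mulVec_mulVec, dotProduct_mulVec, ← mulVec_transpose]
  simp only [dotProduct, mulVec_diagonal]
  exact Finset.sum_congr rfl fun i _ => by ring

lemma nsq_aux {d : ℕ} (U : Matrix (Fin d) (Fin d) ℝ) (hU : U * Uᵀ = 1) (v : Fin d → ℝ) :
    v ⬝ᵥ v = ∑ i, ((Uᵀ).mulVec v i) ^ 2 := by
  have := qform_aux U 1 v
  have h1 : (Matrix.diagonal (1 : Fin d → ℝ)) = 1 := Matrix.diagonal_one
  rw [h1, mul_one, hU, one_mulVec] at this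
  simpa using this

lemma aeval_aux {d : ℕ} (U : Matrix (Fin d) (Fin d) ℝ) (hU : U * Uᵀ = 1) (hU' : Uᵀ * U = 1)
    (D : Fin d → ℝ) (q : Polynomial ℝ) :
    Polynomial.aeval (U * Matrix.diagonal D * Uᵀ) q =
      U * Matrix.diagonal (fun i => q.eval (D i)) * Uᵀ := by
  induction q using Polynomial.induction_on' with
  | add p q hp hq =>
    rw [map_add, hp, hq, ← add_mul, ← mul_add, Matrix.diagonal_add]
    simp
  | monomial n a =>
    rw [Polynomial.aeval_monomial]
    have hpow : (U * Matrix.diagonal D * Uᵀ) ^ n = U * Matrix.diagonal (fun i => D i ^ n) * Uᵀ := by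
      induction n with
      | zero => simp [hU]
      | succ n ih =>
        rw [pow_succ, ih]
        have : U * Matrix.diagonal (fun i => D i ^ n) * Uᵀ * (U * Matrix.diagonal D * Uᵀ)
          = U * Matrix.diagonal (fun i => D i ^ n) * (Uᵀ * U) * Matrix.diagonal D * Uᵀ := by
          simp only [Matrix.mul_assoc]
        rw [this, hU', mul_one, Matrix.mul_assoc U, Matrix.diagonal_mul_diagonal]
        simp [pow_succ]
    rw [hpow, ← Algebra.smul_def]
    have : (Matrix.diagonal fun i => (Polynomial.monomial n a).eval (D i)) =
        a • Matrix.diagonal (fun i => D i ^ n) := by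
      rw [← Matrix.diagonal_smul]
      congr 1
      funext i
      simp
    rw [this]
    simp

lemma krylov_aux {d N : ℕ} (A : Matrix (Fin d) (Fin d) ℝ) (r : Fin d → ℝ) (s : Polynomial ℝ)
    (hs : ∀ i, N ≤ i → s.coeff i = 0) : (Polynomial.aeval A s).mulVec r ∈ krylov A r N := by
  rw [Polynomial.aeval_def, Polynomial.eval₂_eq_sum, Polynomial.sum, Matrix.sum_mulVec]
  refine Submodule.sum_mem _ fun i hi => ?_
  rw [← Algebra.smul_def, Matrix.smul_mulVec]
  refine Submodule.smul_mem _ _ (Submodule.subset_span ⟨i, ?_, rfl⟩)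
  by_contra h
  exact (Polynomial.mem_support_iff.1 hi) (hs i (not_lt.1 h))

lemma nu_finset {d : ℕ} (A : Matrix (Fin d) (Fin d) ℝ) (h : A.IsHermitian) (l : ℕ) (hl : l < d) :
    ∃ T : Finset (Fin d), T.card ≤ l ∧ ∀ i, i ∉ T → h.eigenvalues i ≤ nu A (l + 1) := by
  have hnu : nu A (l + 1) =
      h.eigenvalues (Tuple.sort h.eigenvalues (Fin.rev ⟨l, hl⟩)) := by
    unfold nu
    rw [dif_pos ⟨h, by omega, by omega⟩]
    rfl
  refine ⟨(Finset.univ : Finset (Fin l)).image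
    (fun j : Fin l => Tuple.sort h.eigenvalues (Fin.rev ⟨(j : ℕ), by omega⟩)), ?_, ?_⟩
  · exact Finset.card_image_le.trans (by simp)
  · intro i hi
    obtain ⟨j, rfl⟩ := (Tuple.sort h.eigenvalues).surjective i
    rw [hnu]
    refine Tuple.monotone_sort h.eigenvalues ?_
    by_contra hc
    apply hi
    rw [Finset.mem_image]
    rw [not_le, Fin.lt_def, Fin.val_rev] at hc
    simp only at hc
    refine ⟨⟨d - 1 - j, by omega⟩, Finset.mem_univ _, ?_⟩
    congr 1
    ext
    simp only [Fin.val_rev]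
    omega

lemma nu_nonneg_aux {d : ℕ} (A : Matrix (Fin d) (Fin d) ℝ) (h : A.PosSemidef) (l : ℕ) :
    0 ≤ nu A l := by
  unfold nu
  split_ifs with h'
  · exact h.eigenvalues_nonneg _
  · exact le_rfl

lemma cheb_aux (κ : ℝ) (hκ : 1 ≤ κ) (N : ℕ) : ∃ q : Polynomial ℝ, q.natDegree ≤ N ∧
    q.eval 0 = 1 ∧ ∀ x, 1 ≤ x → x ≤ κ →
      |q.eval x| ≤ 2 * ((Real.sqrt κ - 1) / (Real.sqrt κ + 1)) ^ N := by
  rcases hκ.eq_or_lt with rfl | hκ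
  · refine ⟨(1 - Polynomial.X) ^ N, ?_, by simp, ?_⟩
    · refine Polynomial.natDegree_pow_le.trans ?_
      have : (1 - Polynomial.X : Polynomial ℝ).natDegree ≤ 1 := by compute_degree
      nlinarith
    · intro x h1 h2
      obtain rfl := le_antisymm h1 h2
      rcases N with _ | N <;> simp
  · set s := Real.sqrt κ with hs
    have hs2 : s ^ 2 = κ := Real.sq_sqrt (by linarith)
    have hs1 : 1 < s := by
      rw [hs, Real.lt_sqrt (by norm_num)]; linarith
    set z := (s + 1) / (s - 1) with hz
    have hz0 : 0 < z := div_pos (by linarith) (by linarith)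
    have hx0 : (κ + 1) / (κ - 1) = Real.cosh (Real.log z) := by
      rw [Real.cosh_log hz0, hz, ← hs2]
      have : s - 1 ≠ 0 := by linarith
      have : s + 1 ≠ 0 := by linarith
      have : s ^ 2 - 1 ≠ 0 := by nlinarith
      field_simp
      ring
    set t := (Polynomial.Chebyshev.T ℝ N).eval ((κ + 1) / (κ - 1)) with ht
    have ht2 : z ^ N / 2 ≤ t := by
      rw [ht, hx0, Polynomial.Chebyshev.T_real_cosh, Real.cosh_eq]
      have h1 : Real.exp (((N : ℤ) : ℝ) * Real.log z) = z ^ N := by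
        rw [Int.cast_natCast, Real.exp_nat_mul, Real.exp_log hz0]
      rw [h1]
      have := Real.exp_pos (-(((N : ℤ) : ℝ) * Real.log z))
      linarith
    have ht0 : 0 < t := lt_of_lt_of_le (by positivity) ht2
    have hb : 1 / t ≤ 2 * ((s - 1) / (s + 1)) ^ N := by
      have : (s - 1) / (s + 1) = z⁻¹ := by rw [hz, inv_div]
      rw [this, inv_pow, div_le_iff₀ ht0]
      have hzN : 0 < z ^ N := by positivity
      calc (1 : ℝ) = 2 * (z ^ N)⁻¹ * (z ^ N / 2) := by field_simp
        _ ≤ _ := by gcongr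
    refine ⟨Polynomial.C (1 / t) * (Polynomial.Chebyshev.T ℝ N).comp
      (Polynomial.C ((κ + 1) / (κ - 1)) - Polynomial.C (2 / (κ - 1)) * Polynomial.X), ?_, ?_, ?_⟩
    · refine (Polynomial.natDegree_C_mul_le _ _).trans (Polynomial.natDegree_comp_le.trans ?_)
      rw [Polynomial.Chebyshev.natDegree_T, Int.natAbs_natCast]
      have : (Polynomial.C ((κ + 1) / (κ - 1)) - Polynomial.C (2 / (κ - 1)) * Polynomial.X
        : Polynomial ℝ).natDegree ≤ 1 := by compute_degree
      nlinarith
    · simp [← ht, ht0.ne']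
    · intro x h1 h2
      simp only [Polynomial.eval_mul, Polynomial.eval_C, Polynomial.eval_comp, Polynomial.eval_sub,
        Polynomial.eval_X, abs_mul]
      rw [abs_of_pos (by positivity : 0 < 1 / t)]
      refine le_trans ?_ hb
      refine mul_le_of_le_one_right (by positivity) ?_
      apply Polynomial.Chebyshev.abs_eval_T_real_le_one
      have hk : 0 < κ - 1 := by linarith
      have : (κ + 1) / (κ - 1) - 2 / (κ - 1) * x = (κ + 1 - 2 * x) / (κ - 1) := by ring
      rw [this, abs_div, abs_of_pos hk, div_le_one hk, abs_le]
      constructor <;> linarith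

lemma poly_aux {p : ℕ} (D : Fin p → ℝ) (hD : ∀ i, 1 ≤ D i) (κ : ℝ) (hκ : 1 ≤ κ) (m m' : ℕ)
    (hc : (Finset.univ.filter (fun i => κ < D i)).card ≤ m) :
    ∃ q : Polynomial ℝ, q.natDegree ≤ m + m' ∧ q.eval 0 = 1 ∧
      ∀ i, |q.eval (D i)| ≤ 2 * ((Real.sqrt κ - 1) / (Real.sqrt κ + 1)) ^ m' := by
  obtain ⟨q, hq, hq0, hqb⟩ := cheb_aux κ hκ m'
  set T := Finset.univ.filter (fun i => κ < D i) with hT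
  have hs1 : 1 ≤ Real.sqrt κ := Real.one_le_sqrt.2 hκ
  refine ⟨(∏ j ∈ T, (1 - Polynomial.C (D j)⁻¹ * Polynomial.X)) * q, ?_, ?_, ?_⟩
  · refine Polynomial.natDegree_mul_le.trans (add_le_add ?_ hq)
    refine (Polynomial.natDegree_prod_le _ _).trans (le_trans ?_ hc)
    rw [Finset.card_eq_sum_ones]
    refine Finset.sum_le_sum fun j _ => ?_
    compute_degree
  · simp [Polynomial.eval_prod, hq0]
  · intro i
    have hC : 0 ≤ 2 * ((Real.sqrt κ - 1) / (Real.sqrt κ + 1)) ^ m' := by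
      have : 0 ≤ Real.sqrt κ - 1 := by linarith
      positivity
    rw [Polynomial.eval_mul, Polynomial.eval_prod, abs_mul]
    by_cases hi : i ∈ T
    · have : ∏ j ∈ T, (1 - Polynomial.C (D j)⁻¹ * Polynomial.X).eval (D i) = 0 := by
        refine Finset.prod_eq_zero hi ?_
        have : D i ≠ 0 := by linarith [hD i]
        simp [this]
      rw [this]
      simpa using hC
    · have hiκ : D i ≤ κ := by simpa [hT] using hi
      refine le_trans (mul_le_of_le_one_left (abs_nonneg _) ?_) (hqb _ (hD i) hiκ)
      rw [Finset.abs_prod]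
      refine Finset.prod_le_one (fun _ _ => abs_nonneg _) fun j hj => ?_
      have hj : κ < D j := by simpa [hT] using hj
      have h0 : 0 < D j := by linarith
      have e : (1 - Polynomial.C (D j)⁻¹ * Polynomial.X).eval (D i) = 1 - D i / D j := by
        simp; ring
      have h1 : D i / D j ≤ 1 := (div_le_one h0).2 (by linarith)
      have h2 : 0 ≤ D i / D j := div_nonneg (by linarith [hD i]) h0.le
      rw [e, abs_le]
      constructor <;> linarith

lemma cg_aux {p : ℕ} (Φ : Matrix (Fin p) (Fin p) ℝ) (hΦ : Φ.IsHermitian)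
    (hD : ∀ i, 1 ≤ hΦ.eigenvalues i) (κ : ℝ) (hκ : 1 ≤ κ) (m m' : ℕ)
    (hc : (Finset.univ.filter (fun i => κ < hΦ.eigenvalues i)).card ≤ m)
    (β₀ β βk r : Fin p → ℝ) (hr : r = Φ.mulVec (β₀ - β))
    (hmin : ∀ β' : Fin p → ℝ, β' - β₀ ∈ krylov Φ r (m + m') →
      phiNorm Φ (βk - β) ≤ phiNorm Φ (β' - β)) :
    phiNorm Φ (βk - β) ≤
      2 * ((Real.sqrt κ - 1) / (Real.sqrt κ + 1)) ^ m' * phiNorm Φ (β₀ - β) := by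
  obtain ⟨q, hq, hq0, hqb⟩ := poly_aux _ hD κ hκ m m' hc
  obtain ⟨U, hU', hU, hA⟩ := spec_aux Φ hΦ
  set D := hΦ.eigenvalues with hDdef
  set C := 2 * ((Real.sqrt κ - 1) / (Real.sqrt κ + 1)) ^ m' with hCdef
  have hC : 0 ≤ C := by
    have : 0 ≤ Real.sqrt κ - 1 := by linarith [Real.one_le_sqrt.2 hκ]
    positivity
  set e := β₀ - β with he
  have hmem : (β + (Polynomial.aeval Φ q).mulVec e) - β₀ ∈ krylov Φ r (m + m') := by
    have h1 : q = q.divX * Polynomial.X + 1 := by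
      conv_lhs => rw [← Polynomial.divX_mul_X_add q]
      rw [Polynomial.coeff_zero_eq_eval_zero, hq0, Polynomial.C_1]
    have h2 : (β + (Polynomial.aeval Φ q).mulVec e) - β₀ =
        (Polynomial.aeval Φ q.divX).mulVec r := by
      conv_lhs => rw [h1]
      rw [map_add, map_mul, map_one, Polynomial.aeval_X, Matrix.add_mulVec, Matrix.one_mulVec,
        ← Matrix.mulVec_mulVec, ← hr, he]
      abel
    rw [h2]
    refine krylov_aux _ _ _ fun i hi => ?_
    rw [Polynomial.coeff_divX]
    exact Polynomial.coeff_eq_zero_of_natDegree_lt (by omega)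
  refine (hmin _ hmem).trans ?_
  rw [add_sub_cancel_left]
  unfold phiNorm
  rw [← Real.sqrt_sq hC, ← Real.sqrt_mul (sq_nonneg C)]
  apply Real.sqrt_le_sqrt
  have hco : ∀ i, (Uᵀ).mulVec ((Polynomial.aeval Φ q).mulVec e) i =
      q.eval (D i) * (Uᵀ).mulVec e i := by
    intro i
    rw [hA, aeval_aux U hU hU', mulVec_mulVec, ← Matrix.mul_assoc, ← Matrix.mul_assoc, hU', one_mul,
      ← mulVec_mulVec, mulVec_diagonal]
  have hqf : ∀ v, v ⬝ᵥ Φ.mulVec v = ∑ i, D i * ((Uᵀ).mulVec v i) ^ 2 := by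
    intro v
    conv_lhs => rw [hA]
    exact qform_aux U D v
  rw [hqf, hqf, Finset.mul_sum]
  refine Finset.sum_le_sum fun i _ => ?_
  rw [hco i]
  have h1 : q.eval (D i) ^ 2 ≤ C ^ 2 := by
    rw [← sq_abs]
    exact pow_le_pow_left₀ (abs_nonneg _) (hqb i) 2
  have h2 : 0 ≤ D i * ((Uᵀ).mulVec e i) ^ 2 := mul_nonneg (by linarith [hD i]) (sq_nonneg _)
  nlinarith [mul_le_mul_of_nonneg_right h1 h2]

/-- Counting lemma. -/
lemma count_aux {p : ℕ} (B Φ : Matrix (Fin p) (Fin p) ℝ) (hB : B.PosSemidef)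
    (τ : ℝ) (lam : Fin p → ℝ) (hlam : ∀ j, 0 < lam j)
    (σ : Equiv.Perm (Fin p)) (hσ : Antitone (lam ∘ σ)) (hΦ : Φ.IsHermitian)
    (hΦB : ∀ v : Fin p → ℝ, v ⬝ᵥ Φ.mulVec v =
      τ ^ 2 * ((fun j => lam j * v j) ⬝ᵥ B.mulVec (fun j => lam j * v j)) + v ⬝ᵥ v)
    (k l : ℕ) (hk : k < p) (hl : l < p - k) :
    (Finset.univ.filter (fun i => 1 + τ ^ 2 * lam (σ ⟨k, hk⟩) ^ 2 *
      nu (subRemove B σ k hk.le) (l + 1) < hΦ.eigenvalues i)).card ≤ k + l := by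
  set κ := 1 + τ ^ 2 * lam (σ ⟨k, hk⟩) ^ 2 * nu (subRemove B σ k hk.le) (l + 1) with hκ
  set T := Finset.univ.filter (fun i => κ < hΦ.eigenvalues i) with hT
  by_contra hcon
  rw [not_le] at hcon
  obtain ⟨U, hU', hU, hA⟩ := spec_aux Φ hΦ
  set Bs := subRemove B σ k hk.le with hBs
  have hBsP : Bs.PosSemidef := hB.submatrix _
  obtain ⟨V, hV', hV, hAV⟩ := spec_aux Bs hBsP.isHermitian
  obtain ⟨S, hS, hSb⟩ := nu_finset Bs hBsP.isHermitian l hl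
  have hnu := nu_nonneg_aux Bs hBsP (l + 1)
  set ν := nu Bs (l + 1) with hν
  let ee : Fin (p - k) → Fin p := fun i => σ ⟨k + (i : ℕ), by omega⟩
  have hee : Function.Injective ee := by
    intro a b hab
    have := σ.injective hab
    simp only [Fin.mk.injEq] at this
    ext; omega
  let ext : (T → ℝ) →ₗ[ℝ] (Fin p → ℝ) := Function.ExtendByZero.linearMap ℝ (Subtype.val)
  let L1 : (Fin p → ℝ) →ₗ[ℝ] (Fin k → ℝ) :=
    LinearMap.funLeft ℝ ℝ (fun i : Fin k => σ ⟨i, by omega⟩)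
  let L2 : (Fin p → ℝ) →ₗ[ℝ] (S → ℝ) :=
    (LinearMap.funLeft ℝ ℝ (Subtype.val : S → Fin (p - k))) ∘ₗ (Vᵀ).mulVecLin ∘ₗ
      (LinearMap.funLeft ℝ ℝ ee) ∘ₗ (Matrix.diagonal lam).mulVecLin
  let L : (T → ℝ) →ₗ[ℝ] ((Fin k → ℝ) × (S → ℝ)) := (L1.prod L2) ∘ₗ U.mulVecLin ∘ₗ ext
  have hker : LinearMap.ker L ≠ ⊥ := by
    apply LinearMap.ker_ne_bot_of_finrank_lt
    simp
    omega
  obtain ⟨c, hc, hc0⟩ := (Submodule.ne_bot_iff _).1 hker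
  set v := U.mulVec (ext c) with hv
  rw [LinearMap.mem_ker] at hc
  have hc1 : ∀ i : Fin k, v (σ ⟨i, by omega⟩) = 0 := by
    intro i
    exact congrFun (congrArg Prod.fst hc) i
  set y : Fin p → ℝ := fun j => lam j * v j with hy
  have hc2 : ∀ i ∈ S, (Vᵀ).mulVec (fun i => y (ee i)) i = 0 := by
    intro i hi
    have := congrFun (congrArg Prod.snd hc) ⟨i, hi⟩
    have e1 : (Matrix.diagonal lam).mulVec v = y := by
      funext j; rw [mulVec_diagonal]
    have e2 : L2 v ⟨i, hi⟩ = (Vᵀ).mulVec (fun i => (Matrix.diagonal lam).mulVec v (ee i)) i := rfl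
    rw [← e1, ← e2]
    exact this
  have hUv : (Uᵀ).mulVec v = ext c := by
    rw [hv, mulVec_mulVec, hU', one_mulVec]
  have hy0 : ∀ j, j ∉ Set.range ee → y j = 0 := by
    intro j hj
    obtain ⟨i, rfl⟩ := σ.surjective j
    by_cases hi : (i : ℕ) < k
    · have := hc1 ⟨i, hi⟩
      simp only [hy]
      simp only at this
      rw [this, mul_zero]
    · exact absurd ⟨⟨i - k, by omega⟩, by
        simp only [ee]; congr 1; ext; simp only; omega⟩ hj
  -- upper bound
  have hz : y ⬝ᵥ B.mulVec y = (fun i => y (ee i)) ⬝ᵥ Bs.mulVec (fun i => y (ee i)) := by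
    simp only [dotProduct, mulVec]
    symm
    refine Fintype.sum_of_injective ee hee _ _ (fun j hj => by simp [hy0 j hj]) fun i => ?_
    congr 1
    exact Fintype.sum_of_injective ee hee _ _ (fun j hj => by simp [hy0 j hj]) fun i => rfl
  have hz2 : (fun i => y (ee i)) ⬝ᵥ Bs.mulVec (fun i => y (ee i)) ≤
      ν * ((fun i => y (ee i)) ⬝ᵥ (fun i => y (ee i))) := by
    conv_lhs => rw [hAV]
    rw [qform_aux, nsq_aux V hV, Finset.mul_sum]
    refine Finset.sum_le_sum fun i _ => ?_
    by_cases hi : i ∈ S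
    · rw [hc2 i hi]; simp
    · exact mul_le_mul_of_nonneg_right (hSb i hi) (sq_nonneg _)
  have hz3 : (fun i => y (ee i)) ⬝ᵥ (fun i => y (ee i)) ≤ lam (σ ⟨k, hk⟩) ^ 2 * (v ⬝ᵥ v) := by
    have h1 : (fun i => y (ee i)) ⬝ᵥ (fun i => y (ee i)) ≤
        ∑ i, lam (σ ⟨k, hk⟩) ^ 2 * (v (ee i) * v (ee i)) := by
      simp only [dotProduct]
      refine Finset.sum_le_sum fun i _ => ?_
      have h2 : lam (ee i) ≤ lam (σ ⟨k, hk⟩) := hσ (by simp [Fin.le_def])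
      have h3 := pow_le_pow_left₀ (hlam _).le h2 2
      have := mul_le_mul_of_nonneg_right h3 (mul_self_nonneg (v (ee i)))
      simp only [hy]
      linarith
    refine h1.trans ?_
    rw [← Finset.mul_sum]
    refine mul_le_mul_of_nonneg_left ?_ (sq_nonneg _)
    simp only [dotProduct]
    rw [← Finset.sum_image (f := fun j => v j * v j) (fun a _ b _ h => hee h)]
    exact Finset.sum_le_sum_of_subset_of_nonneg (Finset.subset_univ _)
      fun _ _ _ => mul_self_nonneg _
  have hup : v ⬝ᵥ Φ.mulVec v ≤ κ * (v ⬝ᵥ v) := by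
    rw [hΦB v, hκ, ← hy, hz]
    have := mul_le_mul_of_nonneg_left (hz2.trans (mul_le_mul_of_nonneg_left hz3 hnu)) (sq_nonneg τ)
    linarith
  -- lower bound
  have hext : ∀ i, i ∉ T → ext c i = 0 := by
    intro i hi
    show Function.extend Subtype.val c 0 i = 0
    rw [Function.extend_apply' _ _ _ (by rintro ⟨a, rfl⟩; exact hi a.2)]
    rfl
  have hext' : ∀ i : T, ext c i = c i := fun i =>
    Subtype.val_injective.extend_apply c 0 i
  have hlow : κ * (v ⬝ᵥ v) < v ⬝ᵥ Φ.mulVec v := by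
    conv_rhs => rw [hA]
    rw [qform_aux, nsq_aux U hU, Finset.mul_sum, hUv]
    obtain ⟨i0, hi0⟩ := Function.ne_iff.1 hc0
    refine Finset.sum_lt_sum (fun i _ => ?_) ⟨i0, Finset.mem_univ _, ?_⟩
    · by_cases hi : i ∈ T
      · exact mul_le_mul_of_nonneg_right (Finset.mem_filter.1 hi).2.le (sq_nonneg _)
      · rw [hext i hi]; simp
    · have := (Finset.mem_filter.1 i0.2).2
      refine mul_lt_mul_of_pos_right this ?_
      rw [hext']
      exact sq_pos_of_ne_zero hi0
  linarith

/-- **Theorem 4 (error bound for prior-preconditioned CG).**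
With `Φ̃ = τ² Λ Xᵀ Ω X Λ + I_p`, `β̃ = Φ̃⁻¹ b̃`, `r̃₀ = Φ̃ β̃₀ - b̃`, and
`κ̃_m = 1 + min_{k + ℓ = m} τ² λ_{(k+1)}² ν_{ℓ+1}((XᵀΩX)_{(-k)})`, every minimizer
`β̃_{m+m'}` of the `Φ̃`-norm distance to `β̃` over `β̃₀ + K(Φ̃, r̃₀, m + m')` satisfies
`‖β̃_{m+m'} - β̃‖_{Φ̃} ≤ 2 ((κ̃_m^{1/2} - 1)/(κ̃_m^{1/2} + 1))^{m'} ‖β̃₀ - β̃‖_{Φ̃}`. -/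
theorem prior_preconditioned_cg_error_bound
    {n p : ℕ} (X : Matrix (Fin n) (Fin p) ℝ)
    (w : Fin n → ℝ) (hw : ∀ i, 0 ≤ w i)
    (τ : ℝ) (hτ : 0 < τ)
    (lam : Fin p → ℝ) (hlam : ∀ j, 0 < lam j)
    (σ : Equiv.Perm (Fin p)) (hσ : Antitone (lam ∘ σ))
    (Φt : Matrix (Fin p) (Fin p) ℝ)
    (hΦt : Φt = (τ ^ 2) •
      (Matrix.diagonal lam * (Xᵀ * Matrix.diagonal w * X) * Matrix.diagonal lam) + 1)
    (bt βt₀ βt rt₀ : Fin p → ℝ)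
    (hβt : βt = Φt⁻¹.mulVec bt)
    (hrt₀ : rt₀ = Φt.mulVec βt₀ - bt)
    (m m' : ℕ) (κt : ℝ)
    (hκt : κt = 1 + (Finset.range (m + 1)).inf'
      ⟨0, Finset.mem_range.2 (Nat.succ_pos m)⟩
      (fun k => termKL X w τ lam σ k (m - k)))
    (βk : Fin p → ℝ)
    (hmem : βk - βt₀ ∈ krylov Φt rt₀ (m + m'))
    (hmin : ∀ β' : Fin p → ℝ, β' - βt₀ ∈ krylov Φt rt₀ (m + m') →
      phiNorm Φt (βk - βt) ≤ phiNorm Φt (β' - βt)) :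
    phiNorm Φt (βk - βt) ≤
      2 * ((Real.sqrt κt - 1) / (Real.sqrt κt + 1)) ^ m' * phiNorm Φt (βt₀ - βt) := by
  set B := Xᵀ * Matrix.diagonal w * X with hBdef
  have hB : B.PosSemidef := by
    have h1 : (Matrix.diagonal w).PosSemidef := Matrix.posSemidef_diagonal_iff.2 hw
    have := h1.conjTranspose_mul_mul_same X
    rwa [conjTranspose_eq_transpose_of_trivial] at this
  have hΛ : ∀ v : Fin p → ℝ, (Matrix.diagonal lam).mulVec v = fun j => lam j * v j := by
    intro v; funext j; rw [mulVec_diagonal]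
  have hΦB : ∀ v : Fin p → ℝ, v ⬝ᵥ Φt.mulVec v =
      τ ^ 2 * ((fun j => lam j * v j) ⬝ᵥ B.mulVec (fun j => lam j * v j)) + v ⬝ᵥ v := by
    intro v
    rw [hΦt, Matrix.add_mulVec, Matrix.one_mulVec, dotProduct_add, Matrix.smul_mulVec,
      dotProduct_smul, smul_eq_mul, ← mulVec_mulVec, ← mulVec_mulVec, dotProduct_mulVec,
      ← mulVec_transpose, Matrix.diagonal_transpose, hΛ]
  have hBpos : ∀ y : Fin p → ℝ, 0 ≤ y ⬝ᵥ B.mulVec y := by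
    intro y
    simpa using hB.dotProduct_mulVec_nonneg y
  have hBT : Bᵀ = B := by
    have := hB.isHermitian
    rwa [Matrix.IsHermitian, conjTranspose_eq_transpose_of_trivial] at this
  have hΦ : Φt.IsHermitian := by
    rw [Matrix.IsHermitian, conjTranspose_eq_transpose_of_trivial, hΦt]
    simp only [transpose_add, transpose_smul, transpose_mul, diagonal_transpose, transpose_one, hBT,
      Matrix.mul_assoc]
  have hD : ∀ i, 1 ≤ hΦ.eigenvalues i := by
    obtain ⟨U, hU', hU, hA⟩ := spec_aux Φt hΦ
    intro i
    have h1 := qform_aux U hΦ.eigenvalues (U.mulVec (Pi.single i 1))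
    have h2 := nsq_aux U hU (U.mulVec (Pi.single i 1))
    rw [← hA, hΦB, h2] at h1
    have h3 := mul_nonneg (sq_nonneg τ) (hBpos (fun j => lam j * (U.mulVec (Pi.single i 1)) j))
    rw [mulVec_mulVec, hU', one_mulVec] at h1
    simp [Pi.single_apply, ite_pow] at h1
    simp at h3
    linarith
  have hPD : Φt.PosDef := hΦ.posDef_iff_eigenvalues_pos.2 fun i => by linarith [hD i]
  have hr : rt₀ = Φt.mulVec (βt₀ - βt) := by
    rw [hrt₀, hβt, mulVec_sub, mulVec_mulVec,
      Matrix.mul_nonsing_inv _ ((Matrix.isUnit_iff_isUnit_det _).1 hPD.isUnit), one_mulVec]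
  have hterm : ∀ k l, 0 ≤ termKL X w τ lam σ k l := by
    intro k l
    unfold termKL
    split_ifs with h
    · exact mul_nonneg (by positivity) (nu_nonneg_aux _ (hB.submatrix _) _)
    · exact le_rfl
  have hκ : 1 ≤ κt := by
    have : 0 ≤ (Finset.range (m + 1)).inf' ⟨0, Finset.mem_range.2 (Nat.succ_pos m)⟩
      (fun k => termKL X w τ lam σ k (m - k)) := Finset.le_inf' _ _ fun k _ => hterm _ _
    linarith
  refine cg_aux Φt hΦ hD κt hκ m m' ?_ βt₀ βt βk rt₀ hr hmin
  by_cases hmp : p ≤ m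
  · exact (Finset.card_le_univ _).trans (by simpa using hmp)
  · obtain ⟨k, hk, hk'⟩ := Finset.exists_mem_eq_inf' (s := Finset.range (m + 1))
      ⟨0, Finset.mem_range.2 (Nat.succ_pos m)⟩ (fun k => termKL X w τ lam σ k (m - k))
    rw [Finset.mem_range] at hk
    have hkp : k < p := by omega
    have := count_aux B Φt hB τ lam hlam σ hσ hΦ hΦB k (m - k) hkp (by omega)
    rw [hk', termKL, dif_pos hkp] at hκt
    rw [hκt]
    exact this.trans (by omega)
end

section
/- Let 0 < ν_min ≤ ν_max be real numbers and k ≥ 0 an integer. Then min over Q ∈ P_k of the maximum of |Q(ν)| over ν ∈ [ν_min, ν_max] is at most 2·((√(ν_max/ν_min) − 1)/(√(ν_max/ν_min) + 1))^k; that is, there exists a real polynomial Q of degree at most k with Q(0) = 1 such that |Q(ν)| ≤ 2·((√(ν_max/ν_min) − 1)/(√(ν_max/ν_min) + 1))^k for all ν ∈ [ν_min, ν_max]. -/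
open Polynomial

/-- **Theorem (shifted Chebyshev polynomial bound).**
For `0 < ν_min ≤ ν_max` and `k ≥ 0`, the minimum over polynomials `Q` of degree at most
`k` with `Q(0) = 1` of `max_{ν ∈ [ν_min, ν_max]} |Q(ν)|` is at most
`2 ((√(ν_max/ν_min) - 1)/(√(ν_max/ν_min) + 1))^k`; that is, there exists such a `Q` with
`|Q(ν)| ≤ 2 ((√(ν_max/ν_min) - 1)/(√(ν_max/ν_min) + 1))^k` for all `ν ∈ [ν_min, ν_max]`. -/
theorem chebyshev_polynomial_min_max_bound
    (νmin νmax : ℝ) (h0 : 0 < νmin) (h1 : νmin ≤ νmax) (k : ℕ) :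
    ∃ Q : Polynomial ℝ, Q.natDegree ≤ k ∧ Q.eval 0 = 1 ∧
      ∀ ν ∈ Set.Icc νmin νmax,
        |Q.eval ν| ≤
          2 * ((Real.sqrt (νmax / νmin) - 1) / (Real.sqrt (νmax / νmin) + 1)) ^ k := by
  rcases h1.eq_or_lt with h | h
  · subst h
    rcases Nat.eq_zero_or_pos k with hk | hk
    · subst hk
      exact ⟨1, by simp, by simp, by simp⟩
    · refine ⟨1 - C (νmin⁻¹) * X, ?_, by simp, ?_⟩
      · have : (1 - C (νmin⁻¹) * X : Polynomial ℝ).natDegree ≤ 1 := by compute_degree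
        omega
      · intro ν hν
        have : ν = νmin := le_antisymm hν.2 hν.1
        subst this
        simp [h0.ne', hk.ne']
  · set s := Real.sqrt (νmax / νmin) with hs
    have hs2 : s ^ 2 = νmax / νmin := Real.sq_sqrt (div_nonneg (h0.le.trans h1) h0.le)
    have hs1 : 1 < s := by
      rw [hs, Real.lt_sqrt (by norm_num), lt_div_iff₀ h0]
      linarith
    have hM : νmax = s ^ 2 * νmin := by rw [hs2]; field_simp
    have hd : 0 < νmax - νmin := by linarith
    have hsm : 0 < s - 1 := by linarith
    set σ := (s + 1) / (s - 1) with hσ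
    have hσ0 : 0 < σ := by positivity
    set x0 := (νmax + νmin) / (νmax - νmin) with hx0
    have hx : Real.cosh (Real.log σ) = x0 := by
      rw [Real.cosh_log hσ0, hσ, hx0, hM]
      have h3 : s ^ 2 * νmin - νmin ≠ 0 := by rw [← hM]; exact hd.ne'
      have h4 : s - 1 ≠ 0 := hsm.ne'
      have h5 : s + 1 ≠ 0 := by positivity
      have h6 : s ^ 2 * νmin - νmin = νmin * ((s - 1) * (s + 1)) := by ring
      rw [h6]
      field_simp
      ring
    set t := (Chebyshev.T ℝ (k : ℤ)).eval x0 with ht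
    have ht2 : σ ^ k / 2 ≤ t := by
      rw [ht, ← hx, Chebyshev.T_real_cosh, Real.cosh_eq]
      have : Real.exp (((k : ℤ) : ℝ) * Real.log σ) = σ ^ k := by
        rw [Int.cast_natCast, Real.exp_nat_mul, Real.exp_log hσ0]
      rw [this]
      have := Real.exp_pos (-(((k : ℤ) : ℝ) * Real.log σ))
      linarith
    have hσk : 0 < σ ^ k := by positivity
    have ht0 : 0 < t := by linarith
    refine ⟨C t⁻¹ * (Chebyshev.T ℝ (k : ℤ)).comp (C x0 - C (2 / (νmax - νmin)) * X), ?_, ?_, ?_⟩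
    · refine (natDegree_C_mul_le _ _).trans (natDegree_comp_le.trans ?_)
      rw [Chebyshev.natDegree_T, Int.natAbs_natCast]
      have : (C x0 - C (2 / (νmax - νmin)) * X : Polynomial ℝ).natDegree ≤ 1 := by compute_degree
      nlinarith
    · simp only [eval_mul, eval_C, eval_comp, eval_sub, eval_X, mul_zero, sub_zero]
      exact inv_mul_cancel₀ ht0.ne'
    · intro ν hν
      simp only [eval_mul, eval_C, eval_comp, eval_sub, eval_X]
      have hy : |x0 - 2 / (νmax - νmin) * ν| ≤ 1 := by
        have : x0 - 2 / (νmax - νmin) * ν = (νmax + νmin - 2 * ν) / (νmax - νmin) := by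
          rw [hx0]; ring
        rw [this, abs_div, abs_of_pos hd, div_le_one hd, abs_le]
        constructor <;> linarith [hν.1, hν.2]
      have hT := Chebyshev.abs_eval_T_real_le_one (k : ℤ) hy
      have hr : ((s - 1) / (s + 1)) ^ k = (σ ^ k)⁻¹ := by rw [hσ, ← inv_pow, inv_div]
      rw [hr, abs_mul, abs_of_pos (inv_pos.2 ht0)]
      calc _ ≤ t⁻¹ * 1 := by gcongr
        _ ≤ (σ ^ k / 2)⁻¹ := by rw [mul_one]; gcongr
        _ = _ := by rw [inv_div]; rfl
end

section
/- Let Φ be a p×p real symmetric positive definite matrix with eigenvalues ν₁ ≥ … ≥ ν_p (with multiplicity), b ∈ ℝ^p, β = Φ⁻¹b, and β₀ ∈ ℝ^p with residual r₀ = Φβ₀ − b, β₀ ≠ β. Then for all integers r, k ≥ 0 with r < p, every minimizer β_{r+k} of ‖β' − β‖_Φ over β₀ + K(Φ, r₀, r + k) satisfies ‖β_{r+k} − β‖_Φ / ‖β₀ − β‖_Φ ≤ min_{Q ∈ P_{r+k}} max_{j = 1,…,p} |Q(ν_j)| ≤ 2·((√(ν_{r+1}/ν_p) − 1)/(√(ν_{r+1}/ν_p)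 + 1))^k. -/
open Matrix Polynomial

lemma cheb_eval_half (t : ℝ) (ht : t ≠ 0) (n : ℕ) :
    (Polynomial.Chebyshev.T ℝ (n : ℤ)).eval ((t + t⁻¹) / 2) = (t ^ n + t⁻¹ ^ n) / 2 := by
  induction n using Nat.strong_induction_on with
  | _ n ih =>
    match n with
    | 0 => simp
    | 1 => simp
    | n + 2 =>
      have h1 := ih (n + 1) (by omega)
      have h0 := ih n (by omega)
      push_cast at h1 ⊢
      rw [Polynomial.Chebyshev.T_add_two]
      simp only [eval_sub, eval_mul, eval_X, eval_ofNat, h1, h0]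
      have : t * t⁻¹ = 1 := mul_inv_cancel₀ ht
      generalize t⁻¹ = u at *
      rw [pow_add, pow_add, pow_add, pow_add]
      linear_combination (t ^ n / 2 + u ^ n / 2) * this

/-- Chebyshev residual polynomial on `[a, b]`. -/
lemma cheb_poly (a b : ℝ) (ha : 0 < a) (hab : a ≤ b) (k : ℕ) :
    ∃ P : Polynomial ℝ, P.natDegree ≤ k ∧ P.eval 0 = 1 ∧ ∀ x, a ≤ x → x ≤ b →
      |P.eval x| ≤ 2 * ((Real.sqrt (b / a) - 1) / (Real.sqrt (b / a) + 1)) ^ k := by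
  have hb : 0 < b := lt_of_lt_of_le ha hab
  rcases hab.eq_or_lt with rfl | hlt
  · rcases Nat.eq_zero_or_pos k with rfl | hk
    · exact ⟨1, by simp, by simp, by intro x _ _; norm_num⟩
    · refine ⟨1 - Polynomial.C a⁻¹ * X, ?_, by simp, ?_⟩
      · refine le_trans ?_ hk
        compute_degree
      · intro x h1 h2
        have : x = a := le_antisymm h2 h1
        subst this
        simp [ha.ne', hk.ne']
  · set s := Real.sqrt (b / a) with hs
    have hs1 : 1 < s := by
      rw [hs, Real.lt_sqrt (by norm_num)]
      rw [lt_div_iff₀ ha]; linarith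
    have hss : s ^ 2 = b / a := Real.sq_sqrt (by positivity)
    have hb' : b = s ^ 2 * a := by rw [hss]; field_simp
    set q := (s - 1) / (s + 1) with hq
    have hq0 : 0 < q := div_pos (by linarith) (by linarith)
    have hba : 0 < b - a := by linarith
    have hz : (q⁻¹ + q⁻¹⁻¹) / 2 = (a + b) / (b - a) := by
      rw [inv_inv, div_eq_div_iff (by norm_num) hba.ne', hb', hq]
      have h1 : s - 1 ≠ 0 := by linarith
      have h2 : s + 1 ≠ 0 := by linarith
      field_simp
      ring
    set M := (Polynomial.Chebyshev.T ℝ (k : ℤ)).eval ((a + b) / (b - a)) with hM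
    have hMv : M = (q⁻¹ ^ k + q ^ k) / 2 := by
      rw [hM, ← hz, cheb_eval_half _ (inv_ne_zero hq0.ne'), inv_inv]
    have hMpos : 0 < M := by rw [hMv]; positivity
    refine ⟨Polynomial.C M⁻¹ * (Polynomial.Chebyshev.T ℝ (k : ℤ)).comp
      (Polynomial.C (-2 / (b - a)) * X + Polynomial.C ((a + b) / (b - a))), ?_, ?_, ?_⟩
    · refine (natDegree_C_mul_le _ _).trans ?_
      refine natDegree_comp_le.trans ?_
      rw [Polynomial.Chebyshev.natDegree_T]
      have := natDegree_linear_le (a := (-2 / (b - a))) (b := ((a + b) / (b - a)))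
      simpa using Nat.mul_le_mul_left k this
    · simp [eval_comp, ← hM, hMpos.ne']
    · intro x h1 h2
      simp only [eval_mul, eval_C, eval_comp, eval_add, eval_X, abs_mul]
      have hT : |(Polynomial.Chebyshev.T ℝ (k : ℤ)).eval
          (-2 / (b - a) * x + (a + b) / (b - a))| ≤ 1 := by
        apply Polynomial.Chebyshev.abs_eval_T_real_le_one
        have : -2 / (b - a) * x + (a + b) / (b - a) = (a + b - 2 * x) / (b - a) := by
          field_simp; ring
        rw [this, abs_le, le_div_iff₀ hba, div_le_iff₀ hba]
        constructor <;> linarith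
      have hMi : |M⁻¹| ≤ 2 * q ^ k := by
        rw [abs_of_pos (by positivity), inv_le_iff_one_le_mul₀ hMpos, hMv]
        have h3 : q ^ k * q⁻¹ ^ k = 1 := by rw [← mul_pow, mul_inv_cancel₀ hq0.ne', one_pow]
        nlinarith [sq_nonneg (q ^ k)]
      calc _ ≤ |M⁻¹| * 1 := by gcongr
        _ ≤ _ := by linarith

lemma dot_aeval {p : ℕ} (Φ : Matrix (Fin p) (Fin p) ℝ) (w : Fin p → ℝ) (l : ℝ)
    (h : ∀ x, w ⬝ᵥ Φ.mulVec x = l * (w ⬝ᵥ x)) (Q : Polynomial ℝ) (x : Fin p → ℝ) :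
    w ⬝ᵥ (aeval Φ Q).mulVec x = Q.eval l * (w ⬝ᵥ x) := by
  have hpow : ∀ n : ℕ, w ⬝ᵥ (Φ ^ n).mulVec x = l ^ n * (w ⬝ᵥ x) := by
    intro n
    induction n with
    | zero => simp
    | succ n ih =>
      rw [pow_succ', ← Matrix.mulVec_mulVec, h, ih]; ring
  induction Q using Polynomial.induction_on' with
  | add P R hP hR => simp [Matrix.add_mulVec, hP, hR, add_mul]
  | monomial n a =>
    rw [aeval_monomial, Matrix.algebraMap_eq_diagonal, eval_monomial, mul_assoc, ← hpow]
    rw [← Matrix.mulVec_mulVec]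
    have : (Matrix.diagonal ((algebraMap ℝ (Fin p → ℝ)) a)) = a • (1 : Matrix (Fin p) (Fin p) ℝ) := by
      rw [← Matrix.algebraMap_eq_diagonal, Algebra.algebraMap_eq_smul_one]
    rw [this, Matrix.smul_mulVec, Matrix.one_mulVec, dotProduct_smul, smul_eq_mul]

lemma quad_form {p : ℕ} (Φ : Matrix (Fin p) (Fin p) ℝ)
    (ν : Fin p → ℝ) (v : Fin p → Fin p → ℝ)
    (hortho : ∀ i j, v i ⬝ᵥ v j = if i = j then (1 : ℝ) else 0)
    (h : ∀ j x, v j ⬝ᵥ Φ.mulVec x = ν j * (v j ⬝ᵥ x)) (x : Fin p → ℝ) :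
    x ⬝ᵥ Φ.mulVec x = ∑ j, ν j * (v j ⬝ᵥ x) ^ 2 := by
  have hV : (Matrix.of v) * (Matrix.of v)ᵀ = 1 := by
    ext i j
    rw [Matrix.one_apply, ← hortho i j]
    rfl
  have hV' : (Matrix.of v)ᵀ * (Matrix.of v) = 1 := mul_eq_one_comm.mp hV
  have hx : ∀ y : Fin p → ℝ, x ⬝ᵥ y = ((Matrix.of v).mulVec x) ⬝ᵥ ((Matrix.of v).mulVec y) := by
    intro y
    rw [Matrix.dotProduct_mulVec, ← Matrix.mulVec_transpose, Matrix.mulVec_mulVec, hV',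
      Matrix.one_mulVec]
  rw [hx]
  unfold dotProduct
  refine Finset.sum_congr rfl fun j _ => ?_
  have h1 : (Matrix.of v).mulVec x j = v j ⬝ᵥ x := rfl
  have h2 : (Matrix.of v).mulVec (Φ.mulVec x) j = v j ⬝ᵥ Φ.mulVec x := rfl
  rw [h1, h2, h]
  change _ = ν j * (v j ⬝ᵥ x) ^ 2
  ring

theorem cg_convergence_delay_by_large_eigenvalues {p : ℕ}
    (Φ : Matrix (Fin p) (Fin p) ℝ) (hΦ : Φ.PosDef)
    (ν : Fin p → ℝ) (v : Fin p → Fin p → ℝ)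
    (hortho : ∀ i j, v i ⬝ᵥ v j = if i = j then (1 : ℝ) else 0)
    (heig : ∀ j, Φ.mulVec (v j) = ν j • v j)
    (hmono : Antitone ν)
    (b β₀ β r₀ : Fin p → ℝ)
    (hβ : β = Φ⁻¹.mulVec b) (hne : β₀ ≠ β)
    (hr₀ : r₀ = Φ.mulVec β₀ - b)
    (r k : ℕ) (hr : r < p)
    (βrk : Fin p → ℝ)
    (hmem : βrk - β₀ ∈ krylov Φ r₀ (r + k))
    (hmin : ∀ β' : Fin p → ℝ, β' - β₀ ∈ krylov Φ r₀ (r + k) →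
      phiNorm Φ (βrk - β) ≤ phiNorm Φ (β' - β)) :
    (∀ Q : Polynomial ℝ, Q.natDegree ≤ r + k → Q.eval 0 = 1 →
      ∀ c : ℝ, (∀ j : Fin p, |Q.eval (ν j)| ≤ c) →
        phiNorm Φ (βrk - β) ≤ c * phiNorm Φ (β₀ - β)) ∧
    (∃ Q : Polynomial ℝ, Q.natDegree ≤ r + k ∧ Q.eval 0 = 1 ∧
      ∀ j : Fin p, |Q.eval (ν j)| ≤
        2 * ((Real.sqrt (ν ⟨r, hr⟩ / ν ⟨p - 1, by omega⟩) - 1) /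
          (Real.sqrt (ν ⟨r, hr⟩ / ν ⟨p - 1, by omega⟩) + 1)) ^ k) ∧
    phiNorm Φ (βrk - β) ≤
      2 * ((Real.sqrt (ν ⟨r, hr⟩ / ν ⟨p - 1, by omega⟩) - 1) /
        (Real.sqrt (ν ⟨r, hr⟩ / ν ⟨p - 1, by omega⟩) + 1)) ^ k *
      phiNorm Φ (β₀ - β) := by
  have hsymm : Φᵀ = Φ := by
    have := hΦ.isHermitian.eq
    rwa [Matrix.conjTranspose_eq_transpose_of_trivial] at this
  have hdot : ∀ j x, v j ⬝ᵥ Φ.mulVec x = ν j * (v j ⬝ᵥ x) := by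
    intro j x
    rw [Matrix.dotProduct_mulVec, ← Matrix.mulVec_transpose, hsymm, heig, smul_dotProduct,
      smul_eq_mul]
  have hpos : ∀ j, 0 < ν j := by
    intro j
    have hv : v j ≠ 0 := by
      intro h0
      have := hortho j j
      simp [h0] at this
    have := hΦ.dotProduct_mulVec_pos hv
    simpa [hdot, hortho] using this
  have hquad := quad_form Φ ν v hortho hdot
  have hunit : IsUnit Φ.det := hΦ.det_pos.ne'.isUnit
  have hre : r₀ = Φ.mulVec (β₀ - β) := by
    rw [hr₀, hβ, Matrix.mulVec_sub, Matrix.mulVec_mulVec, Matrix.mul_nonsing_inv _ hunit,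
      Matrix.one_mulVec]
  have part1 : ∀ Q : Polynomial ℝ, Q.natDegree ≤ r + k → Q.eval 0 = 1 →
      ∀ c : ℝ, (∀ j : Fin p, |Q.eval (ν j)| ≤ c) →
        phiNorm Φ (βrk - β) ≤ c * phiNorm Φ (β₀ - β) := by
    intro Q hdeg hQ0 c hc
    have hc0 : 0 ≤ c := (abs_nonneg _).trans (hc ⟨r, hr⟩)
    have hQ : Q = Q.divX * X + 1 := by
      conv_lhs => rw [← Q.divX_mul_X_add]
      rw [Polynomial.coeff_zero_eq_eval_zero, hQ0, map_one]
    have hQe : (aeval Φ Q).mulVec (β₀ - β) = (aeval Φ Q.divX).mulVec r₀ + (β₀ - β) := by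
      conv_lhs => rw [hQ]
      rw [map_add, map_mul, aeval_X, map_one, Matrix.add_mulVec, Matrix.one_mulVec,
        ← Matrix.mulVec_mulVec, ← hre]
    have hK : (aeval Φ Q.divX).mulVec r₀ ∈ krylov Φ r₀ (r + k) := by
      rw [aeval_eq_sum_range, Matrix.sum_mulVec]
      refine Submodule.sum_mem _ fun i hi => ?_
      rw [Matrix.smul_mulVec]
      by_cases hi2 : i < r + k
      · exact Submodule.smul_mem _ _ (Submodule.subset_span ⟨i, hi2, rfl⟩)
      · have : Q.divX.coeff i = 0 := by
          rw [coeff_divX]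
          exact coeff_eq_zero_of_natDegree_lt (by omega)
        rw [this, zero_smul]
        exact Submodule.zero_mem _
    have h1 := hmin (β₀ + (aeval Φ Q.divX).mulVec r₀) (by simpa using hK)
    have h2 : β₀ + (aeval Φ Q.divX).mulVec r₀ - β = (aeval Φ Q).mulVec (β₀ - β) := by
      rw [hQe]; abel
    rw [h2] at h1
    refine h1.trans ?_
    unfold phiNorm
    rw [← Real.sqrt_sq hc0, ← Real.sqrt_mul (sq_nonneg c)]
    apply Real.sqrt_le_sqrt
    rw [hquad, hquad, Finset.mul_sum]
    refine Finset.sum_le_sum fun j _ => ?_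
    rw [dot_aeval Φ (v j) (ν j) (hdot j), mul_pow]
    have h3 : Q.eval (ν j) ^ 2 ≤ c ^ 2 := sq_le_sq' (neg_le_of_abs_le (hc j)) (le_of_abs_le (hc j))
    have h4 : 0 ≤ ν j * (v j ⬝ᵥ (β₀ - β)) ^ 2 := mul_nonneg (hpos j).le (sq_nonneg _)
    nlinarith
  have part2 : ∃ Q : Polynomial ℝ, Q.natDegree ≤ r + k ∧ Q.eval 0 = 1 ∧
      ∀ j : Fin p, |Q.eval (ν j)| ≤
        2 * ((Real.sqrt (ν ⟨r, hr⟩ / ν ⟨p - 1, by omega⟩) - 1) /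
          (Real.sqrt (ν ⟨r, hr⟩ / ν ⟨p - 1, by omega⟩) + 1)) ^ k := by
    have hab : ν ⟨p - 1, by omega⟩ ≤ ν ⟨r, hr⟩ := hmono (by rw [Fin.mk_le_mk]; omega)
    obtain ⟨P, hP1, hP2, hP3⟩ := cheb_poly _ _ (hpos ⟨p - 1, by omega⟩) hab k
    let f : Fin r → ℝ := fun i => ν ⟨i, i.2.trans hr⟩
    refine ⟨(∏ i : Fin r, (1 - Polynomial.C (f i)⁻¹ * X)) * P, ?_, ?_, ?_⟩
    · refine natDegree_mul_le.trans (add_le_add ?_ hP1)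
      refine (natDegree_prod_le _ _).trans ?_
      calc _ ≤ ∑ i : Fin r, 1 := Finset.sum_le_sum fun i _ => by
            show natDegree _ ≤ 1
            compute_degree
        _ = r := by simp
    · simp [eval_prod, hP2]
    · intro j
      rw [eval_mul, eval_prod, abs_mul, Finset.abs_prod]
      by_cases hj : (j : ℕ) < r
      · have h0 : ∏ i : Fin r, |(1 - Polynomial.C (f i)⁻¹ * X).eval (ν j)| = 0 := by
          refine Finset.prod_eq_zero (Finset.mem_univ ⟨j, hj⟩) ?_
          simp [f, (hpos j).ne']
        rw [h0, zero_mul]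
        exact (abs_nonneg _).trans (hP3 _ le_rfl hab)
      · have hx1 : ν ⟨p - 1, by omega⟩ ≤ ν j := hmono (by
          rw [Fin.le_def]; have := j.2; simp only; omega)
        have hx2 : ν j ≤ ν ⟨r, hr⟩ := hmono (by rw [Fin.le_def]; simp only; omega)
        have h1 : ∏ i : Fin r, |(1 - Polynomial.C (f i)⁻¹ * X).eval (ν j)| ≤ 1 := by
          refine Finset.prod_le_one (fun i _ => abs_nonneg _) fun i _ => ?_
          have hfi : 0 < f i := hpos _
          have hle : ν j ≤ f i := hmono (by
            rw [Fin.le_def]; have := i.2; simp only; omega)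
          simp only [eval_sub, eval_one, eval_mul, eval_C, eval_X]
          have h5 : (f i)⁻¹ * ν j ≤ 1 := by
            rw [inv_mul_le_iff₀ hfi]; linarith
          have h6 : 0 < (f i)⁻¹ * ν j := mul_pos (inv_pos.mpr hfi) (hpos j)
          rw [abs_le]; constructor <;> linarith
        calc _ ≤ 1 * |P.eval (ν j)| := by gcongr
          _ ≤ _ := by rw [one_mul]; exact hP3 _ hx1 hx2
  refine ⟨part1, part2, ?_⟩
  obtain ⟨Q, h1, h2, h3⟩ := part2
  exact part1 Q h1 h2 _ h3
end
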